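/- Let X be an n × p integer matrix with n ≥ p that is totally unimodular, meaning every square submatrix of X has determinant in {−1, 0, 1}. Then det(Xᵀ X) equals the number of p-element subsets S of the row indices {1, …, n} such that the p × p submatrix X_S of X formed by the rows indexed by S is invertible. Consequently, the robustness of the design with model matrix X satisfies r(X) = det(Xᵀ X) / C(n, p), so robustness is proportional to the determinant of the information matrix. -/

import Mathlib

open Matrix

/-- Expansion of the determinant of a product by multilinearity in the rows. -/
theorem Matrix.det_mul_eq_sum_fun {m n R : Type*} [Fintype m] [DecidableEq m] [Fintype n]
    [DecidableEq n] [CommRing R] (A : Matrix m n R) (B : Matrix n m R) :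
    (A * B).det = ∑ f : m → n, (∏ i, A i (f i)) * (B.submatrix f id).det := by
  have hrows : A * B = fun i => ∑ k, A i k • B k := by
    ext i j
    simp [Matrix.mul_apply, Finset.sum_apply]
  have hexpand := (Matrix.detRowAlternating (R := R) (n := m)).toMultilinearMap.map_sum
    (fun i k => A i k • B k)
  have hdet : (A * B).det = ∑ f : m → n, Matrix.det (fun i => A i (f i) • B (f i)) := by
    rw [hrows]
    exact hexpand
  rw [hdet]
  refine Finset.sum_congr rfl fun f _ => ?_
  exact Matrix.det_mul_column (fun i => A i (f i)) (B.submatrix f id)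

/-- The terms of the expansion of `det (A * B)` indexed by functions with the same image as a
given injective `g` add up to the product of the two minors selected by `g`. -/
theorem Matrix.sum_fun_image_eq_det_mul_det {m n R : Type*} [Fintype m] [DecidableEq m]
    [Fintype n] [DecidableEq n] [CommRing R] (A : Matrix m n R) (B : Matrix n m R)
    {g : m → n} (hg : Function.Injective g) :
    ∑ f : m → n with Finset.univ.image f = Finset.univ.image g,
        (∏ i, A i (f i)) * (B.submatrix f id).det =
      (A.submatrix id g).det * (B.submatrix g id).det := by
  rw [← Matrix.det_transpose (A.submatrix id g), Matrix.det_apply', Finset.sum_mul]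
  symm
  refine Finset.sum_bij (fun (σ : Equiv.Perm m) _ => g ∘ σ) ?_ ?_ ?_ ?_
  · intro σ _
    simp [← Finset.image_image, Finset.image_univ_equiv]
  · intro σ _ τ _ h
    exact Equiv.ext fun i => hg (congrFun h i)
  · intro f hf
    have himage : Finset.univ.image f = Finset.univ.image g := by simpa using hf
    have hlift : ∀ i, ∃ j, g j = f i := fun i => by
      have hi : f i ∈ Finset.univ.image g := himage ▸ Finset.mem_image_of_mem f (Finset.mem_univ i)
      simpa using hi
    choose s hs using hlift
    have hsurj : Function.Surjective s := fun j => by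
      have hj : g j ∈ Finset.univ.image f := himage ▸ Finset.mem_image_of_mem g (Finset.mem_univ j)
      obtain ⟨i, -, hi⟩ := Finset.mem_image.mp hj
      exact ⟨i, hg ((hs i).trans hi)⟩
    exact ⟨Equiv.ofBijective s (Finite.surjective_iff_bijective.mp hsurj), Finset.mem_univ _,
      funext hs⟩
  · intro σ _
    have hperm := Matrix.det_permute σ (B.submatrix g id)
    rw [Matrix.submatrix_submatrix, Function.id_comp] at hperm
    rw [hperm]
    simp only [Matrix.transpose_apply, Matrix.submatrix_apply, id_eq, Function.comp_apply]
    ring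

/-- An integer matrix is invertible over `ℚ` iff its determinant is nonzero. -/
theorem Matrix.isUnit_map_intCast_rat_iff {m : Type*} [Fintype m] [DecidableEq m]
    (M : Matrix m m ℤ) : IsUnit (M.map ((↑) : ℤ → ℚ)) ↔ M.det ≠ 0 := by
  have hdet : (M.map ((↑) : ℤ → ℚ)).det = (M.det : ℚ) :=
    ((Int.castRingHom ℚ).map_det M).symm
  rw [Matrix.isUnit_iff_isUnit_det, hdet, isUnit_iff_ne_zero, Int.cast_ne_zero]

/-- The square of a nonzero maximal minor of a totally unimodular matrix is one. -/
theorem Matrix.IsTotallyUnimodular.det_mul_self_eq_one {n : Type*} {p : ℕ}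
    {X : Matrix n (Fin p) ℤ} (hX : X.IsTotallyUnimodular) {f : Fin p → n}
    (hf : (X.submatrix f id).det ≠ 0) :
    (X.submatrix f id).det * (X.submatrix f id).det = 1 := by
  obtain ⟨s, hs⟩ := (Matrix.isTotallyUnimodular_iff X).mp hX p f id
  rw [← hs] at hf ⊢
  clear hs
  cases s <;> simp_all

/-- For a totally unimodular `n × p` model matrix `X` with `n ≥ p`, the determinant of the
information matrix `Xᵀ * X` equals the number of saturated `p`-element subsets of rows
(i.e. `p`-subsets whose corresponding `p × p` row-submatrix is invertible); consequently
the robustness `r(X)` (the proportion of saturated `p`-subsets among all `p`-subsets)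
equals `det (Xᵀ * X) / C(n, p)`. -/
theorem det_info_matrix_eq_card_saturated_of_isTotallyUnimodular
    {n p : ℕ} (X : Matrix (Fin n) (Fin p) ℤ) (hnp : p ≤ n)
    (hTU : X.IsTotallyUnimodular) :
    (Xᵀ * X).det =
      ({S : Finset (Fin n) | S.card = p ∧ ∃ f : Fin p → Fin n,
          Function.Injective f ∧ Finset.image f Finset.univ = S ∧
          IsUnit ((X.submatrix f id).map ((↑) : ℤ → ℚ))}.ncard : ℤ) ∧
    (({S : Finset (Fin n) | S.card = p ∧ ∃ f : Fin p → Fin n,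
          Function.Injective f ∧ Finset.image f Finset.univ = S ∧
          IsUnit ((X.submatrix f id).map ((↑) : ℤ → ℚ))}.ncard : ℚ)) / (n.choose p : ℚ) =
      (((Xᵀ * X).det : ℚ)) / (n.choose p : ℚ) := by
  classical
  set P : Finset (Fin n) → Prop := fun S => S.card = p ∧ ∃ f : Fin p → Fin n,
    Function.Injective f ∧ Finset.image f Finset.univ = S ∧
      IsUnit ((X.submatrix f id).map ((↑) : ℤ → ℚ))
  have hdet : (Xᵀ * X).det = ({S | P S}.ncard : ℤ) := by
    have hcard : {S | P S}.ncard = (Finset.univ.filter P).card := by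
      rw [← Set.ncard_coe_finset]
      simp
    rw [hcard, Finset.card_filter, Nat.cast_sum, Matrix.det_mul_eq_sum_fun,
      ← Finset.sum_fiberwise Finset.univ (fun f : Fin p → Fin n => Finset.univ.image f)]
    refine Finset.sum_congr rfl fun S _ => ?_
    by_cases hS : P S
    · obtain ⟨-, g, hg, rfl, hunit⟩ := id hS
      rw [if_pos hS, Matrix.sum_fun_image_eq_det_mul_det _ _ hg, ← Matrix.transpose_submatrix,
        Matrix.det_transpose,
        hTU.det_mul_self_eq_one ((Matrix.isUnit_map_intCast_rat_iff _).mp hunit), Nat.cast_one]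
    · rw [if_neg hS, Nat.cast_zero]
      refine Finset.sum_eq_zero fun f hf => mul_eq_zero_of_right _ ?_
      have himage : Finset.univ.image f = S := by simpa using hf
      by_contra hne
      have hinj : Function.Injective f := fun i j hij => by
        by_contra hij'
        exact hne (Matrix.det_zero_of_row_eq hij' (by ext k; simp [hij]))
      refine hS ⟨?_, f, hinj, himage, (Matrix.isUnit_map_intCast_rat_iff _).mpr hne⟩
      rw [← himage, Finset.card_image_of_injective _ hinj, Finset.card_univ, Fintype.card_fin]
  refine ⟨hdet, ?_⟩
  rw [hdet, Int.cast_natCast]
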